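/- arXiv:math-ph/0510006 — 3 statements merged into one kernel-verified Lean document; each statement's English description precedes it below -/
import Mathlib

section
/- (Scattering length for soft potentials) Let W(x) = λw(x) on ℝ² with λ ≥ 0, w ≥ 0, w ∈ L¹(ℝ²), ∫w = 1, and W of finite range R₀. Then for R ≥ R₀ the 2D scattering length satisfies a_scatt = R·exp(−(4π + η(λ,R))/λ) with η(λ,R) → 0 as λ → 0. Equivalently, E_R = ½λ(1 + o(1)) as λ → 0 (the error may depend on R). -/
noncomputable section

open MeasureTheory Real Filter Topology

abbrev E2 : Type := EuclideanSpace ℝ (Fin 2)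

/-- The 2D zero-energy scattering energy
`E_R = min { ∫_{|x|≤R} (|∇ψ|² + ½W|ψ|²) : ψ = 1 on |x| = R }`. -/
def scattE (W : E2 → ℝ) (R : ℝ) : ℝ :=
  sInf { e | ∃ ψ : E2 → ℝ, ContDiff ℝ (⊤ : ℕ∞) ψ ∧ (∀ x : E2, R ≤ ‖x‖ → ψ x = 1) ∧
    e = ∫ x in Metric.ball (0 : E2) R, (‖fderiv ℝ ψ x‖ ^ 2 + W x * ψ x ^ 2 / 2) }

/-- The 2D scattering length, defined through `a_scatt = R e^{-2π/E_R}`. -/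
def aScatt (W : E2 → ℝ) (R : ℝ) : ℝ := R * Real.exp (-(2 * π) / scattE W R)

lemma setInt_ball_eq (f : E2 → ℝ) (R : ℝ) (hf : ∀ x : E2, R < ‖x‖ → f x = 0) :
    ∫ x in Metric.ball (0 : E2) R, f x = ∫ x, f x := by
  apply setIntegral_eq_integral_of_ae_compl_eq_zero
  have h : ∀ᵐ x : E2, x ∉ Metric.sphere (0 : E2) R :=
    measure_eq_zero_iff_ae_notMem.mp (Measure.addHaar_sphere volume (0 : E2) R)
  filter_upwards [h] with x hx hxb
  apply hf
  simp only [Metric.mem_ball, mem_sphere_iff_norm, sub_zero, dist_zero_right, not_lt] at hx hxb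
  exact lt_of_le_of_ne hxb (Ne.symm hx)

lemma fderiv_zero_out (ψ : E2 → ℝ) (R : ℝ) (h1 : ∀ x : E2, R ≤ ‖x‖ → ψ x = 1)
    (x : E2) (hx : R < ‖x‖) : fderiv ℝ ψ x = 0 := by
  have hev : ψ =ᶠ[𝓝 x] fun _ => (1 : ℝ) := by
    filter_upwards [(isOpen_lt continuous_const continuous_norm).mem_nhds hx] with y hy
    exact h1 y (le_of_lt hy)
  rw [hev.fderiv_eq]
  simp

lemma int_ball {f : E2 → ℝ} (hf : Continuous f) (R : ℝ) :
    IntegrableOn f (Metric.ball (0 : E2) R) :=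
  (hf.continuousOn.integrableOn_compact (isCompact_closedBall (0 : E2) R)).mono_set
    Metric.ball_subset_closedBall

lemma poincare (R : ℝ) : ∃ K : ℝ, 0 ≤ K ∧ ∀ ψ : E2 → ℝ, ContDiff ℝ (⊤ : ℕ∞) ψ →
    (∀ x : E2, R ≤ ‖x‖ → ψ x = 1) →
    ∫ x in Metric.ball (0 : E2) R, |ψ x - 1| ≤
      K * ∫ x in Metric.ball (0 : E2) R, ‖fderiv ℝ ψ x‖ := by
  refine ⟨eLpNormLESNormFDerivOfLeConst ℝ (volume : Measure E2) (Metric.ball (0 : E2) R) 1 1,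
    NNReal.coe_nonneg _, ?_⟩
  intro ψ hψ h1
  have hu : ContDiff ℝ 1 (fun x => ψ x - 1) :=
    (hψ.of_le (by exact_mod_cast le_top)).sub contDiff_const
  have hfd : ∀ x, fderiv ℝ (fun x => ψ x - 1) x = fderiv ℝ ψ x := fun x => by
    rw [fderiv_sub_const]
  have hcd : Continuous (fun x => fderiv ℝ ψ x) := hψ.continuous_fderiv (by simp)
  have hsupp : (fun x => ψ x - 1).support ⊆ Metric.ball (0 : E2) R := by
    intro x hx
    by_contra hxb
    simp only [Metric.mem_ball, dist_zero_right, not_lt] at hxb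
    exact hx (by simp [h1 x hxb])
  have key := eLpNorm_le_eLpNorm_fderiv (volume : Measure E2) hu hsupp (p := 1) le_rfl
    (by simp) Metric.isBounded_ball
  have e1 : fderiv ℝ (fun x => ψ x - 1) = fderiv ℝ ψ := funext hfd
  rw [e1] at key
  rw [setInt_ball_eq _ R (fun x hx => by simp [h1 x hx.le]),
    setInt_ball_eq _ R (fun x hx => by simp [fderiv_zero_out ψ R h1 x hx])]
  have hi : Integrable (fderiv ℝ ψ) := by
    apply hcd.integrable_of_hasCompactSupport
    apply HasCompactSupport.intro (isCompact_closedBall (0 : E2) R)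
    intro x hx
    apply fderiv_zero_out ψ R h1
    simpa using hx
  simp only [ENNReal.coe_one, eLpNorm_one_eq_lintegral_enorm] at key
  have hr := ENNReal.toReal_mono
    (ENNReal.mul_ne_top ENNReal.coe_ne_top hi.2.ne) key
  rw [ENNReal.toReal_mul, ENNReal.coe_toReal, ← integral_norm_eq_lintegral_enorm hi.1,
    ← integral_norm_eq_lintegral_enorm hu.continuous.aestronglyMeasurable] at hr
  simpa only [Real.norm_eq_abs] using hr

lemma lower (w : E2 → ℝ) (R : ℝ)
    (hw0 : ∀ x, 0 ≤ w x) (hwint : Integrable w)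
    (hwr : ∀ x : E2, R < ‖x‖ → w x = 0) (M : ℝ) (hM : 0 ≤ M) :
    ∃ A : ℝ, ∀ lam : ℝ, 0 < lam → ∀ ψ : E2 → ℝ, ContDiff ℝ (⊤ : ℕ∞) ψ →
      (∀ x : E2, R ≤ ‖x‖ → ψ x = 1) →
      lam / 2 * (∫ x, min (w x) M) - lam ^ 2 * A ≤
        ∫ x in Metric.ball (0 : E2) R, (‖fderiv ℝ ψ x‖ ^ 2 + lam * w x * ψ x ^ 2 / 2) := by
  obtain ⟨K, hK, hP⟩ := poincare R
  refine ⟨(M * K / 2) ^ 2 * volume.real (Metric.ball (0 : E2) R), ?_⟩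
  intro lam hlam ψ hψ h1
  set c : ℝ := lam * M * K / 2 with hc
  have hcd : Continuous (fun x => fderiv ℝ ψ x) := hψ.continuous_fderiv (by simp)
  have hψc := hψ.continuous
  have hmin : Integrable (fun x => min (w x) M) := by
    refine hwint.mono (hwint.1.inf aestronglyMeasurable_const) (ae_of_all _ fun x => ?_)
    rw [Real.norm_of_nonneg (le_min (hw0 x) hM), Real.norm_of_nonneg (hw0 x)]
    exact min_le_left _ _
  have i1 : IntegrableOn (fun x => 2 * c * ‖fderiv ℝ ψ x‖) (Metric.ball (0 : E2) R) :=
    int_ball (by fun_prop) R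
  have i2 : IntegrableOn (fun _ => c ^ 2) (Metric.ball (0 : E2) R) :=
    int_ball (by fun_prop) R
  have i3 : IntegrableOn (fun x => lam / 2 * min (w x) M) (Metric.ball (0 : E2) R) :=
    (hmin.const_mul _).integrableOn
  have i4 : IntegrableOn (fun x => lam * M * |ψ x - 1|) (Metric.ball (0 : E2) R) :=
    int_ball (by fun_prop) R
  have i5 : IntegrableOn (fun x => ‖fderiv ℝ ψ x‖ ^ 2 + lam * w x * ψ x ^ 2 / 2)
      (Metric.ball (0 : E2) R) := by
    refine IntegrableOn.add (int_ball (by fun_prop) R) ?_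
    have : IntegrableOn (fun x => w x * (lam * ψ x ^ 2 / 2)) (Metric.closedBall (0 : E2) R) :=
      hwint.integrableOn.mul_continuousOn (by fun_prop) (isCompact_closedBall _ _)
    refine (this.mono_set Metric.ball_subset_closedBall).congr_fun (fun x _ => ?_)
      measurableSet_ball
    ring
  have hle := setIntegral_mono (((i1.sub i2).add i3).sub i4) i5 (fun x => by
    show 2 * c * ‖fderiv ℝ ψ x‖ - c ^ 2 + lam / 2 * min (w x) M - lam * M * |ψ x - 1|
      ≤ ‖fderiv ℝ ψ x‖ ^ 2 + lam * w x * ψ x ^ 2 / 2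
    have a1 : 0 ≤ min (w x) M := le_min (hw0 x) hM
    have a2 : min (w x) M ≤ w x := min_le_left _ _
    have a3 : min (w x) M ≤ M := min_le_right _ _
    generalize min (w x) M = m at a1 a2 a3
    have b1 := sq_nonneg (‖fderiv ℝ ψ x‖ - c)
    have b2 : m * ψ x ^ 2 ≤ w x * ψ x ^ 2 := by gcongr
    have b3 : m * (1 - 2 * |ψ x - 1|) ≤ m * ψ x ^ 2 := by
      apply mul_le_mul_of_nonneg_left _ a1
      nlinarith [neg_abs_le (ψ x - 1), sq_nonneg (ψ x - 1)]
    have b4 : m * |ψ x - 1| ≤ M * |ψ x - 1| := by gcongr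
    have b5 : lam * (m - 2 * (M * |ψ x - 1|)) ≤ lam * (w x * ψ x ^ 2) := by
      apply mul_le_mul_of_nonneg_left _ hlam.le
      linarith
    nlinarith)
  refine le_trans ?_ hle
  have e : ∫ x in Metric.ball (0 : E2) R, (((fun x => 2 * c * ‖fderiv ℝ ψ x‖) - (fun _ => c ^ 2)
      + (fun x => lam / 2 * min (w x) M)) - (fun x => lam * M * |ψ x - 1|) : E2 → ℝ) x
      = 2 * c * (∫ x in Metric.ball (0 : E2) R, ‖fderiv ℝ ψ x‖)
        - c ^ 2 * volume.real (Metric.ball (0 : E2) R)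
        + lam / 2 * (∫ x, min (w x) M)
        - lam * M * ∫ x in Metric.ball (0 : E2) R, |ψ x - 1| := by
    rw [integral_sub' ((i1.sub i2).add i3) i4, integral_add' (i1.sub i2) i3, integral_sub' i1 i2,
      integral_const_mul, integral_const_mul, integral_const_mul, setIntegral_const,
      setInt_ball_eq (fun x => min (w x) M) R (fun x hx => by simp [hwr x hx, hM])]
    simp only [smul_eq_mul]
    ring
  refine le_trans ?_ e.ge
  have hp := mul_le_mul_of_nonneg_left (hP ψ hψ h1) (mul_nonneg hlam.le hM)
  have : c ^ 2 = lam ^ 2 * (M * K / 2) ^ 2 := by rw [hc]; ring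
  rw [this]
  have h2 : 2 * c = lam * M * K := by rw [hc]; ring
  rw [h2]
  linarith

lemma scattE_bounds (w : E2 → ℝ) (R : ℝ)
    (hw0 : ∀ x, 0 ≤ w x) (hwnorm : (∫ x, w x) = 1)
    (hwr : ∀ x : E2, R < ‖x‖ → w x = 0) (lam : ℝ) (hlam : 0 < lam) :
    scattE (fun x => lam * w x) R ≤ lam / 2 ∧
    ∀ b : ℝ, (∀ ψ : E2 → ℝ, ContDiff ℝ (⊤ : ℕ∞) ψ → (∀ x : E2, R ≤ ‖x‖ → ψ x = 1) →
      b ≤ ∫ x in Metric.ball (0 : E2) R, (‖fderiv ℝ ψ x‖ ^ 2 + lam * w x * ψ x ^ 2 / 2)) →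
      b ≤ scattE (fun x => lam * w x) R := by
  have hone : lam / 2 = ∫ x in Metric.ball (0 : E2) R,
      (‖fderiv ℝ (fun _ : E2 => (1 : ℝ)) x‖ ^ 2 + lam * w x * (1 : ℝ) ^ 2 / 2) := by
    rw [setInt_ball_eq _ R (fun x hx => by simp [hwr x hx])]
    have : (fun x => ‖fderiv ℝ (fun _ : E2 => (1 : ℝ)) x‖ ^ 2 + lam * w x * (1 : ℝ) ^ 2 / 2)
        = fun x => lam / 2 * w x := by
      funext x
      simp
      ring
    rw [this, integral_const_mul, hwnorm, mul_one]
  constructor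
  · apply csInf_le
    · refine ⟨0, ?_⟩
      rintro e ⟨ψ, -, -, rfl⟩
      apply integral_nonneg
      intro x
      have := hw0 x
      dsimp only
      positivity
    · exact ⟨fun _ => 1, contDiff_const, fun _ _ => rfl, hone⟩
  · intro b hb
    apply le_csInf
    · exact ⟨_, fun _ => 1, contDiff_const, fun _ _ => rfl, rfl⟩
    · rintro e ⟨ψ, h1, h2, rfl⟩
      exact hb ψ h1 h2

lemma trunc_tendsto (w : E2 → ℝ) (hw0 : ∀ x, 0 ≤ w x) (hwint : Integrable w) :
    Tendsto (fun n : ℕ => ∫ x, min (w x) (n : ℝ)) atTop (𝓝 (∫ x, w x)) := by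
  apply tendsto_integral_of_dominated_convergence w
  · intro n
    exact hwint.1.inf aestronglyMeasurable_const
  · exact hwint
  · intro n
    refine ae_of_all _ fun x => ?_
    rw [Real.norm_of_nonneg (le_min (hw0 x) (Nat.cast_nonneg n))]
    exact min_le_left _ _
  · refine ae_of_all _ fun x => ?_
    apply tendsto_const_nhds.congr'
    filter_upwards [eventually_ge_atTop ⌈w x⌉₊] with n hn
    exact (min_eq_left (Nat.ceil_le.mp hn)).symm

lemma ratio_tendsto (w : E2 → ℝ) (R : ℝ)
    (hw0 : ∀ x, 0 ≤ w x) (hwint : Integrable w) (hwnorm : (∫ x, w x) = 1)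
    (hwr : ∀ x : E2, R < ‖x‖ → w x = 0) :
    Tendsto (fun lam => scattE (fun x => lam * w x) R / lam) (nhdsWithin 0 (Set.Ioi 0))
      (𝓝 (1 / 2)) := by
  rw [tendsto_order]
  constructor
  · intro a ha
    have ht := trunc_tendsto w hw0 hwint
    rw [hwnorm] at ht
    obtain ⟨n, hn⟩ := (ht.eventually (lt_mem_nhds (show 2 * a < 1 by linarith))).exists
    obtain ⟨A, hA⟩ := lower w R hw0 hwint hwr n (Nat.cast_nonneg n)
    have hlim : Tendsto (fun lam : ℝ => (∫ x, min (w x) (n : ℝ)) / 2 - lam * A)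
        (nhdsWithin 0 (Set.Ioi 0)) (𝓝 ((∫ x, min (w x) (n : ℝ)) / 2 - 0 * A)) :=
      ((by fun_prop : Continuous (fun lam : ℝ => (∫ x, min (w x) (n : ℝ)) / 2 - lam * A)).tendsto
        0).mono_left nhdsWithin_le_nhds
    filter_upwards [hlim.eventually (lt_mem_nhds (show a < _ by linarith)),
      self_mem_nhdsWithin] with lam h1 h2
    have h2 : 0 < lam := h2
    have hb := (scattE_bounds w R hw0 hwnorm hwr lam h2).2 _ (hA lam h2)
    refine lt_of_lt_of_le h1 ?_
    rw [le_div_iff₀ h2]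
    refine le_trans (le_of_eq ?_) hb
    ring
  · intro a ha
    filter_upwards [self_mem_nhdsWithin] with lam h2
    have h2 : 0 < lam := h2
    have hb := (scattE_bounds w R hw0 hwnorm hwr lam h2).1
    refine lt_of_le_of_lt ?_ ha
    rw [div_le_iff₀ h2]
    linarith

/-- **Scattering length for soft potentials** (Lemma 4.1).
If `W = λw` with `λ ≥ 0`, `w ≥ 0`, `w ∈ L¹(ℝ²)`, `∫w = 1` and `W` of finite
range `R₀`, then for `R ≥ R₀` the 2D scattering length satisfies
`a_scatt = R exp(−(4π + η(λ,R))/λ)` with `η(λ,R) → 0` as `λ → 0`. -/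
theorem scattering_length_soft_potentials
    (w : E2 → ℝ) (R0 R : ℝ)
    (hw0 : ∀ x, 0 ≤ w x) (hwint : Integrable w) (hwnorm : (∫ x, w x) = 1)
    (hR0 : 0 < R0) (hwrange : ∀ x : E2, R0 < ‖x‖ → w x = 0) (hR : R0 ≤ R) :
    ∃ η : ℝ → ℝ, Tendsto η (nhdsWithin 0 (Set.Ioi 0)) (nhds 0) ∧
      ∀ lam : ℝ, 0 < lam →
        aScatt (fun x => lam * w x) R = R * Real.exp (-((4 * π + η lam) / lam)) := by
  have hwr : ∀ x : E2, R < ‖x‖ → w x = 0 := fun x hx => hwrange x (lt_of_le_of_lt hR hx)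
  have ht := ratio_tendsto w R hw0 hwint hwnorm hwr
  refine ⟨fun lam => 2 * π / (scattE (fun x => lam * w x) R / lam) - 4 * π, ?_, ?_⟩
  · have := ((tendsto_const_nhds (x := 2 * π)).div ht (by norm_num)).sub
      (tendsto_const_nhds (x := 4 * π))
    have h0 : 2 * π / (1 / 2) - 4 * π = 0 := by ring
    rw [h0] at this
    exact this
  · intro lam hlam
    unfold aScatt
    congr 2
    have : lam ≠ 0 := hlam.ne'
    rw [add_sub_cancel, div_div_eq_mul_div, div_right_comm, mul_div_assoc, div_self this, mul_one,
      neg_div]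

end
end

section
/- (Scattering length for scaled soft potentials) Let W_{R,λ}(x) = λR⁻²w₁(x/R) on ℝ² with w₁ ≥ 0 fixed, w₁ ∈ L¹(ℝ²), ∫w₁ = 1, and w₁ of finite range. Then the 2D scattering length of W_{R,λ} equals R·exp(−(4π + η(λ))/λ) with η(λ) → 0 as λ → 0, where η is independent of R. -/
noncomputable section

open MeasureTheory Real Filter Topology

lemma aux_ball (R : ℝ) (f : E2 → ℝ) (hR : 0 < R) (hf : ∀ x : E2, R < ‖x‖ → f x = 0) :
    ∫ x in Metric.ball (0 : E2) R, f x = ∫ x, f x := by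
  apply setIntegral_eq_integral_of_ae_compl_eq_zero
  have h : (volume : Measure E2) (Metric.sphere 0 R) = 0 :=
    Measure.addHaar_sphere_of_ne_zero volume 0 hR.ne'
  have h2 : ∀ᵐ x : E2, x ∉ Metric.sphere (0 : E2) R := measure_eq_zero_iff_ae_notMem.1 h
  filter_upwards [h2] with x hx hxb
  apply hf
  simp only [mem_sphere_iff_norm, sub_zero, mem_ball_iff_norm, not_lt] at hx hxb
  exact lt_of_le_of_ne hxb (Ne.symm hx)

lemma aux_fderiv_zero (R : ℝ) (φ : E2 → ℝ) (h : ∀ x : E2, R ≤ ‖x‖ → φ x = 0) (x : E2)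
    (hx : R < ‖x‖) : fderiv ℝ φ x = 0 := by
  have : φ =ᶠ[𝓝 x] fun _ => (0 : ℝ) := by
    filter_upwards [(isOpen_lt continuous_const continuous_norm).mem_nhds hx] with y hy
    exact h y (le_of_lt hy)
  rw [this.fderiv_eq]
  simp

lemma aux_compact (R : ℝ) {F : Type*} [Zero F] (φ : E2 → F) (h : ∀ x : E2, R < ‖x‖ → φ x = 0) :
    HasCompactSupport φ := by
  apply HasCompactSupport.intro (isCompact_closedBall (0 : E2) R)
  intro x hx
  apply h
  simpa using hx

/-- Cauchy-Schwarz on a ball. -/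
lemma aux_cs (R : ℝ) (hR : 0 < R) : ∃ V : ℝ, 0 < V ∧ ∀ g : E2 → ℝ, Continuous g →
    (∀ x : E2, R < ‖x‖ → g x = 0) → (∫ x, g x) ^ 2 ≤ V * ∫ x, g x ^ 2 := by
  set V : ℝ := (volume : Measure E2).real (Metric.ball 0 R) with hV
  have hVpos : 0 < V := ENNReal.toReal_pos (Metric.measure_ball_pos volume _ hR).ne'
    measure_ball_lt_top.ne
  refine ⟨V, hVpos, fun g hg h0 => ?_⟩
  have hgi : IntegrableOn g (Metric.ball (0 : E2) R) :=
    (hg.integrable_of_hasCompactSupport (aux_compact R g h0)).integrableOn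
  have hg2i : IntegrableOn (fun x => g x ^ 2) (Metric.ball (0 : E2) R) :=
    ((hg.pow 2).integrable_of_hasCompactSupport
      (aux_compact R _ (fun x hx => by simp [h0 x hx]))).integrableOn
  rw [← aux_ball R g hR h0, ← aux_ball R (fun x => g x ^ 2) hR (fun x hx => by simp [h0 x hx])]
  set G := ∫ x in Metric.ball (0 : E2) R, g x
  set Q := ∫ x in Metric.ball (0 : E2) R, g x ^ 2
  have key : ∫ x in Metric.ball (0 : E2) R, (g x ^ 2 - (2 * (G / V)) * g x + (G / V) ^ 2)
      = Q - 2 * (G / V) * G + (G / V) ^ 2 * V := by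
    have hc : IntegrableOn (fun _ : E2 => (G / V) ^ 2) (Metric.ball (0 : E2) R) :=
      integrableOn_const measure_ball_lt_top.ne
    have hd : IntegrableOn (fun x => g x ^ 2 - (2 * (G / V)) * g x) (Metric.ball (0 : E2) R) :=
      hg2i.sub (hgi.const_mul _)
    rw [integral_add hd hc, integral_sub hg2i (hgi.const_mul _),
      integral_const_mul, setIntegral_const]
    simp only [smul_eq_mul, ← hV]
    ring
  have pos : 0 ≤ ∫ x in Metric.ball (0 : E2) R, (g x ^ 2 - (2 * (G / V)) * g x + (G / V) ^ 2) := by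
    apply integral_nonneg
    intro x
    have := sq_nonneg (g x - G / V)
    simp only [Pi.zero_apply]
    linarith
  rw [key] at pos
  have : Q - 2 * (G / V) * G + (G / V) ^ 2 * V = Q - G ^ 2 / V := by
    field_simp
    ring
  rw [this] at pos
  have h3 : G ^ 2 / V ≤ Q := by linarith
  rw [div_le_iff₀ hVpos] at h3
  linarith

lemma aux_gns : ∃ C : ℝ, 0 ≤ C ∧ ∀ φ : E2 → ℝ, ContDiff ℝ 1 φ → HasCompactSupport φ →
    ∫ x, φ x ^ 2 ≤ C * (∫ x, ‖fderiv ℝ φ x‖) ^ 2 := by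
  refine ⟨lintegralPowLePowLIntegralFDerivConst (volume : Measure E2) 2, NNReal.coe_nonneg _,
    fun φ hφ hc => ?_⟩
  have hp : Real.HolderConjugate (Module.finrank ℝ E2 : ℝ) 2 := by
    rw [finrank_euclideanSpace_fin]
    exact_mod_cast Real.HolderConjugate.two_two
  have h := lintegral_pow_le_pow_lintegral_fderiv (volume : Measure E2) hφ hc hp
  have hcd : Continuous (fderiv ℝ φ) := hφ.continuous_fderiv (by norm_num)
  have hi : Integrable (fderiv ℝ φ) := hcd.integrable_of_hasCompactSupport (hc.fderiv ℝ)
  have hc2 : HasCompactSupport (fun x => φ x ^ 2) := by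
    refine hc.mono fun x hx => ?_
    simp only [Function.mem_support] at hx ⊢
    intro h0
    simp [h0] at hx
  have e1 : ∫⁻ x, ‖φ x‖ₑ ^ (2 : ℝ) = ENNReal.ofReal (∫ x, φ x ^ 2) := by
    rw [ofReal_integral_eq_lintegral_ofReal]
    · congr 1
      ext x
      rw [← ofReal_norm, ENNReal.ofReal_rpow_of_nonneg (norm_nonneg _) (by norm_num)]
      simp
    · exact (hφ.continuous.pow 2).integrable_of_hasCompactSupport
        hc2
    · exact Eventually.of_forall fun x => sq_nonneg _
  have e2 : ∫⁻ x, ‖fderiv ℝ φ x‖ₑ = ENNReal.ofReal (∫ x, ‖fderiv ℝ φ x‖) :=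
    (ofReal_integral_norm_eq_lintegral_enorm hi).symm
  have hG : 0 ≤ ∫ x, ‖fderiv ℝ φ x‖ := integral_nonneg fun _ => norm_nonneg _
  rw [e1, e2, ENNReal.ofReal_rpow_of_nonneg hG (by norm_num), ← ENNReal.ofReal_coe_nnreal,
    ← ENNReal.ofReal_mul (NNReal.coe_nonneg _), ENNReal.ofReal_le_ofReal_iff (by positivity)] at h
  simpa using h

lemma aux_poincare (R : ℝ) (hR : 0 < R) : ∃ K : ℝ, 0 < K ∧ ∀ φ : E2 → ℝ, ContDiff ℝ 1 φ →
    (∀ x : E2, R ≤ ‖x‖ → φ x = 0) → ∫ x, φ x ^ 2 ≤ K * ∫ x, ‖fderiv ℝ φ x‖ ^ 2 := by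
  obtain ⟨C, hC, h1⟩ := aux_gns
  obtain ⟨V, hV, h2⟩ := aux_cs R hR
  refine ⟨C * V + 1, by positivity, fun φ hφ h0 => ?_⟩
  have a := h1 φ hφ (aux_compact R φ fun x hx => h0 x hx.le)
  have b := h2 (fun x => ‖fderiv ℝ φ x‖) (hφ.continuous_fderiv (by norm_num)).norm
    (fun x hx => by simp [aux_fderiv_zero R φ h0 x hx])
  have c : 0 ≤ ∫ x, ‖fderiv ℝ φ x‖ ^ 2 := integral_nonneg fun _ => sq_nonneg _
  have d := mul_le_mul_of_nonneg_left b hC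
  nlinarith

/-- The energy in terms of the whole-space integrals; lower bound. -/
lemma aux_lower (w : E2 → ℝ) (R0 : ℝ) (hw0 : ∀ x, 0 ≤ w x) (hwint : Integrable w)
    (hR0 : 0 < R0) (hwr : ∀ x : E2, R0 < ‖x‖ → w x = 0) :
    ∃ K : ℝ, 0 < K ∧ ∀ M s lam : ℝ, 0 < M → 0 < s → 0 < lam → lam * M * K ≤ 2 * s →
    ∀ ψ : E2 → ℝ, ContDiff ℝ (⊤ : ℕ∞) ψ → (∀ x : E2, R0 ≤ ‖x‖ → ψ x = 1) →
    lam / 2 * ((1 - s) * ∫ x, min (w x) M) ≤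
      ∫ x in Metric.ball (0 : E2) R0, (‖fderiv ℝ ψ x‖ ^ 2 + lam * w x * ψ x ^ 2 / 2) := by
  obtain ⟨K, hK, hP⟩ := aux_poincare R0 hR0
  refine ⟨K, hK, fun M s lam hM hs hlam hsmall ψ hψ hψ1 => ?_⟩
  have hψC : Continuous ψ := hψ.continuous
  set φ : E2 → ℝ := fun x => ψ x - 1 with hφdef
  have hφ : ContDiff ℝ 1 φ := (hψ.of_le (by exact_mod_cast le_top)).sub contDiff_const
  have hφ0 : ∀ x : E2, R0 ≤ ‖x‖ → φ x = 0 := fun x hx => by simp [hφdef, hψ1 x hx]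
  have hfd : ∀ x, fderiv ℝ ψ x = fderiv ℝ φ x := fun x => by simp [hφdef, fderiv_sub_const]
  have hφs := aux_compact R0 φ fun x hx => hφ0 x hx.le
  have hfz := aux_fderiv_zero R0 φ hφ0
  have hDc : Continuous (fderiv ℝ φ) := hφ.continuous_fderiv (by norm_num)
  have hD : Integrable (fun x => ‖fderiv ℝ φ x‖ ^ 2) :=
    (hDc.norm.pow 2).integrable_of_hasCompactSupport
      (aux_compact R0 _ fun x hx => by simp [hfz x hx])
  have hφ2 : Integrable (fun x => φ x ^ 2) :=
    (hφ.continuous.pow 2).integrable_of_hasCompactSupport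
      (aux_compact R0 _ fun x hx => by simp [hφ0 x hx.le])
  have hwψ : Integrable (fun x => w x * ψ x ^ 2) := by
    have h1 : Integrable (fun x => w x * ((φ x) ^ 2 + 2 * φ x)) := by
      have hc : Continuous (fun x => (φ x) ^ 2 + 2 * φ x) := by
        have := hφ.continuous
        fun_prop
      have hcs : HasCompactSupport (fun x => (φ x) ^ 2 + 2 * φ x) :=
        aux_compact R0 _ fun x hx => by simp [hφ0 x hx.le]
      obtain ⟨B, hB⟩ := hcs.exists_bound_of_continuous hc
      exact hwint.mul_bdd hc.aestronglyMeasurable (Eventually.of_forall hB)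
    refine (h1.add hwint).congr (Eventually.of_forall fun x => ?_)
    simp only [Pi.add_apply, hφdef]
    ring
  have hm : Integrable (fun x => min (w x) M) := by
    refine hwint.mono (hwint.aestronglyMeasurable.inf aestronglyMeasurable_const)
      (Eventually.of_forall fun x => ?_)
    rw [Real.norm_eq_abs, Real.norm_eq_abs, abs_of_nonneg (le_min (hw0 x) hM.le),
      abs_of_nonneg (hw0 x)]
    exact min_le_left _ _
  rw [aux_ball R0 _ hR0 (fun x hx => by simp [hfd, hfz x hx, hwr x hx])]
  have e : ∫ x, (‖fderiv ℝ ψ x‖ ^ 2 + lam * w x * ψ x ^ 2 / 2) =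
      (∫ x, ‖fderiv ℝ φ x‖ ^ 2) + lam / 2 * ∫ x, w x * ψ x ^ 2 := by
    rw [← integral_const_mul, ← integral_add hD (hwψ.const_mul _)]
    congr 1
    ext x
    rw [hfd]
    ring
  rw [e]
  have l : ∫ x, ((1 - s) * min (w x) M - M / s * φ x ^ 2) ≤ ∫ x, w x * ψ x ^ 2 := by
    apply integral_mono ((hm.const_mul _).sub (hφ2.const_mul _)) hwψ
    intro x
    change (1 - s) * min (w x) M - M / s * φ x ^ 2 ≤ w x * ψ x ^ 2
    have a1 : min (w x) M ≤ w x := min_le_left _ _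
    have a2 : min (w x) M ≤ M := min_le_right _ _
    have a0 : 0 ≤ min (w x) M := le_min (hw0 x) hM.le
    set m := min (w x) M
    have hψφ : ψ x = 1 + φ x := by simp [hφdef]
    have b1 : m * ψ x ^ 2 ≤ w x * ψ x ^ 2 := mul_le_mul_of_nonneg_right a1 (sq_nonneg _)
    have b2 : (1 - s) - 1 / s * φ x ^ 2 ≤ ψ x ^ 2 := by
      rw [hψφ]
      have : 0 ≤ (s + φ x) ^ 2 / s := by positivity
      have e3 : (s + φ x) ^ 2 / s = s + 2 * φ x + 1 / s * φ x ^ 2 := by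
        field_simp
        ring
      nlinarith [sq_nonneg (φ x)]
    have b3 := mul_le_mul_of_nonneg_left b2 a0
    have b4 : m * (1 / s * φ x ^ 2) ≤ M * (1 / s * φ x ^ 2) :=
      mul_le_mul_of_nonneg_right a2 (by positivity)
    have b5 : M / s * φ x ^ 2 = M * (1 / s * φ x ^ 2) := by ring
    rw [b5]
    linarith
  rw [integral_sub (hm.const_mul _) (hφ2.const_mul _), integral_const_mul, integral_const_mul] at l
  have p := hP φ hφ hφ0
  have hD0 : 0 ≤ ∫ x, ‖fderiv ℝ φ x‖ ^ 2 := integral_nonneg fun _ => sq_nonneg _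
  set D := ∫ x, ‖fderiv ℝ φ x‖ ^ 2
  set P := ∫ x, φ x ^ 2
  set I := ∫ x, min (w x) M
  have l2 := mul_le_mul_of_nonneg_left l (by positivity : 0 ≤ lam / 2)
  have p2 : lam / 2 * (M / s * P) ≤ D := by
    calc lam / 2 * (M / s * P) ≤ lam / 2 * (M / s * (K * D)) := by gcongr
      _ = (lam * M * K) / (2 * s) * D := by field_simp
      _ ≤ 1 * D := by
        gcongr
        rw [div_le_one (by positivity)]
        exact hsmall
      _ = D := one_mul D
  nlinarith

lemma aux_min_tendsto (w : E2 → ℝ) (hw0 : ∀ x, 0 ≤ w x) (hwint : Integrable w) :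
    Tendsto (fun n : ℕ => ∫ x, min (w x) ((n : ℝ) + 1)) atTop (𝓝 (∫ x, w x)) := by
  apply tendsto_integral_of_dominated_convergence w
  · intro n
    exact hwint.aestronglyMeasurable.inf aestronglyMeasurable_const
  · exact hwint
  · intro n
    refine Eventually.of_forall fun x => ?_
    rw [Real.norm_eq_abs, abs_of_nonneg (le_min (hw0 x) (by positivity))]
    exact min_le_left _ _
  · refine Eventually.of_forall fun x => ?_
    obtain ⟨N, hN⟩ := exists_nat_ge (w x)
    apply tendsto_const_nhds.congr'
    filter_upwards [eventually_ge_atTop N] with n hn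
    have : (N : ℝ) ≤ n := by exact_mod_cast hn
    rw [min_eq_left (by linarith)]

lemma aux_scaleE (w : E2 → ℝ) (R0 lam R : ℝ) (hR : 0 < R) :
    scattE (fun x => lam * R⁻¹ ^ 2 * w (R⁻¹ • x)) (R * R0) = scattE (fun x => lam * w x) R0 := by
  have key : ∀ ψ : E2 → ℝ,
      ∫ x in Metric.ball (0 : E2) R0, (‖fderiv ℝ (fun y => ψ (R • y)) x‖ ^ 2
        + lam * w x * ψ (R • x) ^ 2 / 2) =
      ∫ x in Metric.ball (0 : E2) (R * R0), (‖fderiv ℝ ψ x‖ ^ 2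
        + lam * R⁻¹ ^ 2 * w (R⁻¹ • x) * ψ x ^ 2 / 2) := by
    intro ψ
    have h := Measure.setIntegral_comp_smul_of_pos (volume : Measure E2)
      (fun x => R ^ 2 * (‖fderiv ℝ ψ x‖ ^ 2
        + lam * R⁻¹ ^ 2 * w (R⁻¹ • x) * ψ x ^ 2 / 2)) (Metric.ball (0 : E2) R0) hR
    rw [finrank_euclideanSpace_fin, smul_ball hR.ne', smul_zero,
      Real.norm_eq_abs, abs_of_pos hR, smul_eq_mul, integral_const_mul (R ^ 2) (fun x => ‖fderiv ℝ ψ x‖ ^ 2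
        + lam * R⁻¹ ^ 2 * w (R⁻¹ • x) * ψ x ^ 2 / 2), ← mul_assoc,
      inv_mul_cancel₀ (by positivity), one_mul] at h
    rw [← h]
    congr 1
    ext x
    rw [fderiv_comp_smul, norm_smul, Real.norm_eq_abs, abs_of_pos hR, smul_smul,
      inv_mul_cancel₀ hR.ne', one_smul]
    field_simp
  unfold scattE
  congr 1
  ext e
  constructor
  · rintro ⟨ψ, h1, h2, h3⟩
    refine ⟨fun y => ψ (R • y), h1.comp (contDiff_const_smul R), fun x hx => ?_, ?_⟩
    · apply h2
      rw [norm_smul, Real.norm_eq_abs, abs_of_pos hR]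
      gcongr
    · rw [h3]
      exact (key ψ).symm
  · rintro ⟨χ, h1, h2, h3⟩
    refine ⟨fun y => χ (R⁻¹ • y), h1.comp (contDiff_const_smul R⁻¹), fun x hx => ?_, ?_⟩
    · apply h2
      rw [norm_smul, norm_inv, Real.norm_eq_abs, abs_of_pos hR, ← div_eq_inv_mul,
        le_div_iff₀ hR]
      linarith
    · rw [h3]
      have h := key (fun y => χ (R⁻¹ • y))
      simp only [smul_smul, inv_mul_cancel₀ hR.ne', one_smul] at h
      exact h

lemma aux_limit (w₁ : E2 → ℝ) (R0 : ℝ)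
    (hw0 : ∀ x, 0 ≤ w₁ x) (hwint : Integrable w₁) (hwnorm : (∫ x, w₁ x) = 1)
    (hR0 : 0 < R0) (hwrange : ∀ x : E2, R0 < ‖x‖ → w₁ x = 0) :
    Tendsto (fun lam => scattE (fun x => lam * w₁ x) R0 / lam) (𝓝[>] 0) (𝓝 (1 / 2)) := by
  have hone : ∀ lam : ℝ, lam / 2 ∈ { e | ∃ ψ : E2 → ℝ, ContDiff ℝ (⊤ : ℕ∞) ψ ∧
      (∀ x : E2, R0 ≤ ‖x‖ → ψ x = 1) ∧
      e = ∫ x in Metric.ball (0 : E2) R0,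
        (‖fderiv ℝ ψ x‖ ^ 2 + lam * w₁ x * ψ x ^ 2 / 2) } := by
    intro lam
    refine ⟨fun _ => 1, contDiff_const, fun _ _ => rfl, ?_⟩
    rw [aux_ball R0 _ hR0 (fun x hx => by simp [hwrange x hx])]
    have : ∀ x, ‖fderiv ℝ (fun _ : E2 => (1 : ℝ)) x‖ ^ 2 + lam * w₁ x * 1 ^ 2 / 2
        = lam / 2 * w₁ x := fun x => by simp; ring
    simp_rw [this]
    rw [integral_const_mul, hwnorm, mul_one]
  have hup : ∀ lam : ℝ, 0 < lam → scattE (fun x => lam * w₁ x) R0 / lam ≤ 1 / 2 := by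
    intro lam hlam
    rw [div_le_iff₀ hlam]
    have : scattE (fun x => lam * w₁ x) R0 ≤ lam / 2 := by
      apply csInf_le _ (hone lam)
      refine ⟨0, ?_⟩
      rintro e ⟨ψ, -, -, rfl⟩
      apply integral_nonneg
      intro x
      have := hw0 x
      simp only [Pi.zero_apply]
      positivity
    linarith
  obtain ⟨K, hK, hlow⟩ := aux_lower w₁ R0 hw0 hwint hR0 hwrange
  rw [tendsto_order]
  constructor
  · intro c hc
    have ht : Tendsto (fun n : ℕ => (1 - 1 / ((n : ℝ) + 1)) *
        ∫ x, min (w₁ x) ((n : ℝ) + 1)) atTop (𝓝 ((1 - 0) * 1)) := by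
      refine (tendsto_const_nhds.sub tendsto_one_div_add_atTop_nhds_zero_nat).mul ?_
      have := aux_min_tendsto w₁ hw0 hwint
      rwa [hwnorm] at this
    obtain ⟨n, hn⟩ := (ht.eventually_const_lt (u := 2 * c) (by linarith)).exists
    set M : ℝ := (n : ℝ) + 1
    have hM : 0 < M := by positivity
    have hs : 0 < 1 / M := by positivity
    have hδ : 0 < 2 * (1 / M) / (M * K) := by positivity
    filter_upwards [Ioo_mem_nhdsGT hδ] with lam hl
    obtain ⟨hl0, hl1⟩ := hl
    rw [lt_div_iff₀ (by positivity)] at hl1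
    have : lam / 2 * ((1 - 1 / M) * ∫ x, min (w₁ x) M) ≤ scattE (fun x => lam * w₁ x) R0 := by
      apply le_csInf ⟨_, hone lam⟩
      rintro e ⟨ψ, h1, h2, rfl⟩
      exact hlow M (1 / M) lam hM hs hl0 (by linarith) ψ h1 h2
    rw [lt_div_iff₀ hl0]
    nlinarith
  · intro c hc
    filter_upwards [self_mem_nhdsWithin] with lam hl
    exact lt_of_le_of_lt (hup lam hl) hc

/-- **Scattering length for scaled soft potentials** (Corollary 4.2).
If `W_{R,λ}(x) = λ R⁻² w₁(x/R)` with `w₁ ≥ 0` fixed, `w₁ ∈ L¹(ℝ²)`, `∫w₁ = 1`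
and `w₁` of finite range `R₀`, then the 2D scattering length of `W_{R,λ}`
(computed at radius `R·R₀`, i.e. at the range of `W_{R,λ}`) equals
`R exp(−(4π + η(λ))/λ)` with `η(λ) → 0` as `λ → 0`, `η` independent of `R`. -/
theorem scattering_length_scaled_soft_potentials
    (w₁ : E2 → ℝ) (R0 : ℝ)
    (hw0 : ∀ x, 0 ≤ w₁ x) (hwint : Integrable w₁) (hwnorm : (∫ x, w₁ x) = 1)
    (hR0 : 0 < R0) (hwrange : ∀ x : E2, R0 < ‖x‖ → w₁ x = 0) :
    ∃ η : ℝ → ℝ, Tendsto η (nhdsWithin 0 (Set.Ioi 0)) (nhds 0) ∧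
      ∀ lam : ℝ, 0 < lam → ∀ R : ℝ, 0 < R →
        aScatt (fun x => lam * R⁻¹ ^ 2 * w₁ (R⁻¹ • x)) (R * R0)
          = R * Real.exp (-((4 * π + η lam) / lam)) := by
  refine ⟨fun lam => lam * (2 * π / scattE (fun x => lam * w₁ x) R0 - Real.log R0) - 4 * π,
    ?_, ?_⟩
  · have h := aux_limit w₁ R0 hw0 hwint hwnorm hR0 hwrange
    have hl : Tendsto (fun lam : ℝ => lam) (𝓝[>] 0) (𝓝 0) := tendsto_nhdsWithin_of_tendsto_nhds tendsto_id
    have h2 := (((h.inv₀ (by norm_num)).const_mul (2 * π)).sub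
      (hl.mul_const (Real.log R0))).sub_const (4 * π)
    have e : 2 * π * (1 / 2 : ℝ)⁻¹ - 0 * Real.log R0 - 4 * π = 0 := by ring
    rw [e] at h2
    refine h2.congr fun lam => ?_
    rw [inv_div]
    ring
  · intro lam hlam R hR
    unfold aScatt
    rw [aux_scaleE w₁ R0 lam R hR]
    have e : -((4 * π + (lam * (2 * π / scattE (fun x => lam * w₁ x) R0 - Real.log R0)
        - 4 * π)) / lam) = Real.log R0 + -(2 * π) / scattE (fun x => lam * w₁ x) R0 := by
      rw [add_sub_cancel, mul_div_cancel_left₀ _ hlam.ne']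
      ring
    rw [e, Real.exp_add, Real.exp_log hR0, mul_assoc]


end
end

section
/- Let Λ₂ ⊂ ℝ² be a box of side ℓ and let Ψ(𝐱₁,…,𝐱ₙ) = ∏_{i<j} F(|x_i − x_j|) ∏_{k=1}^n s_h(z_k), where 0 ≤ F ≤ 1 and F(r) = 1 for r ≥ b, and s_h is normalized in L²(ℝ). Then ∫_{Λ₂ⁿ×ℝⁿ}|Ψ|² ≥ ℓ^{2n}·[1 − (π/2)n(n−1)b²/ℓ²]. -/
noncomputable section

open MeasureTheory Real

/-- the planar box of side `l` -/
def box2 (l : ℝ) : Set E2 := {x | ∀ j : Fin 2, x j ∈ Set.Icc (0 : ℝ) l}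

lemma box2_eq (l : ℝ) : box2 l = (MeasurableEquiv.toLp 2 (Fin 2 → ℝ)).symm ⁻¹'
    (Set.univ.pi fun _ => Set.Icc (0 : ℝ) l) := by
  ext x; simp only [box2, Set.mem_preimage, Set.mem_pi, Set.mem_univ, true_implies]; rfl

lemma measurableSet_box2 (l : ℝ) : MeasurableSet (box2 l) := by
  rw [box2_eq]
  exact (MeasurableEquiv.measurable _) (MeasurableSet.univ_pi fun _ => measurableSet_Icc)

lemma volume_box2 (l : ℝ) : volume (box2 l) = ENNReal.ofReal l ^ 2 := by
  rw [box2_eq, (EuclideanSpace.volume_preserving_symm_measurableEquiv_toLp (Fin 2)).measure_preimage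
    (MeasurableSet.univ_pi fun _ => measurableSet_Icc).nullMeasurableSet]
  rw [volume_pi_pi]
  simp

/-- the configuration box -/
def cbox (n : ℕ) (l : ℝ) : Set (Fin n → E2) := Set.univ.pi fun _ => box2 l

lemma measurableSet_cbox (n : ℕ) (l : ℝ) : MeasurableSet (cbox n l) :=
  MeasurableSet.univ_pi fun _ => measurableSet_box2 l

lemma volume_cbox (n : ℕ) (l : ℝ) : volume (cbox n l) = ENNReal.ofReal l ^ (2 * n) := by
  rw [cbox, volume_pi_pi]
  simp [volume_box2, pow_mul]

lemma volume_pair (m : ℕ) (l b : ℝ) (i j : Fin (m + 1)) (hij : i ≠ j) :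
    volume (cbox (m + 1) l ∩ {X | dist (X i) (X j) < b}) ≤
      ENNReal.ofReal b ^ 2 * ENNReal.ofReal π * ENNReal.ofReal l ^ (2 * m) := by
  obtain ⟨k, rfl⟩ := Fin.exists_succAbove_eq hij.symm
  let T : Set (E2 × (Fin m → E2)) :=
    {p | dist p.1 (p.2 k) < b} ∩ Prod.snd ⁻¹' cbox m l
  have hT : MeasurableSet T := by
    refine MeasurableSet.inter ?_ (measurable_snd (measurableSet_cbox m l))
    exact measurableSet_lt (measurable_fst.dist ((measurable_pi_apply k).comp measurable_snd))
      measurable_const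
  have hmp := volume_preserving_piFinSuccAbove (fun _ : Fin (m + 1) => E2) i
  calc volume (cbox (m + 1) l ∩ {X | dist (X i) (X (i.succAbove k)) < b})
      ≤ volume ((MeasurableEquiv.piFinSuccAbove (fun _ : Fin (m + 1) => E2) i) ⁻¹' T) := by
        apply measure_mono
        rintro X ⟨hX, hd⟩
        refine ⟨hd, ?_⟩
        intro j _
        exact hX (i.succAbove j) trivial
    _ = volume T := hmp.measure_preimage hT.nullMeasurableSet
    _ = ∫⁻ y : Fin m → E2, volume ((fun x : E2 => (x, y)) ⁻¹' T) := by
        rw [Measure.volume_eq_prod, Measure.prod_apply_symm hT]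
    _ ≤ ∫⁻ y : Fin m → E2, (cbox m l).indicator
          (fun _ => ENNReal.ofReal b ^ 2 * ENNReal.ofReal π) y := by
        apply lintegral_mono
        intro y
        by_cases hy : y ∈ cbox m l
        · rw [Set.indicator_of_mem hy]
          have := EuclideanSpace.volume_ball_fin_two (y k) b
          calc _ ≤ volume (Metric.ball (y k) b) := measure_mono fun x hx => hx.1
            _ ≤ _ := by rw [this]
        · have : (fun x : E2 => (x, y)) ⁻¹' T = ∅ := by
            ext x; simp [T, hy]
          simp [this]
    _ = _ := by
        rw [lintegral_indicator (measurableSet_cbox m l), setLIntegral_const, volume_cbox]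

lemma real_pair (n : ℕ) (l b : ℝ) (hl : 0 < l) (hb : 0 < b) (i j : Fin n) (hij : i ≠ j) :
    volume.real (cbox n l ∩ {X | dist (X i) (X j) < b}) ≤ l ^ (2 * n) * (π * b ^ 2 / l ^ 2) := by
  obtain _ | m := n
  · exact i.elim0
  have h := ENNReal.toReal_mono (by finiteness) (volume_pair m l b i j hij)
  simp only [ENNReal.toReal_mul, ENNReal.toReal_pow, ENNReal.toReal_ofReal hb.le,
    ENNReal.toReal_ofReal hl.le, ENNReal.toReal_ofReal pi_pos.le] at h
  refine h.trans (le_of_eq ?_)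
  rw [mul_add, pow_add]
  field_simp

lemma card_pairs (n : ℕ) :
    ((Finset.univ.filter fun p : Fin n × Fin n => p.1 < p.2).card : ℝ) = n * (n - 1) / 2 := by
  have h1 : (Finset.univ.filter fun p : Fin n × Fin n => p.2 < p.1).card =
      (Finset.univ.filter fun p : Fin n × Fin n => p.1 < p.2).card :=
    Finset.card_equiv (Equiv.prodComm _ _) (by simp)
  have h2 : (Finset.univ.filter fun p : Fin n × Fin n => p.1 = p.2).card = n := by
    have := Finset.diag_card (Finset.univ : Finset (Fin n))
    rw [Finset.card_univ, Fintype.card_fin] at this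
    refine Eq.trans (congrArg Finset.card ?_) this
    ext p; simp
  have h3 : n * n = (Finset.univ.filter fun p : Fin n × Fin n => p.1 < p.2).card +
      ((Finset.univ.filter fun p : Fin n × Fin n => p.2 < p.1).card +
      (Finset.univ.filter fun p : Fin n × Fin n => p.1 = p.2).card) := by
    rw [← Finset.card_union_of_disjoint, ← Finset.card_union_of_disjoint]
    · have : (n * n) = (Finset.univ : Finset (Fin n × Fin n)).card := by simp
      rw [this]; congr 1; ext p
      simp only [Finset.mem_univ, Finset.mem_union, Finset.mem_filter, true_and, true_iff]
      rcases lt_trichotomy p.1 p.2 with h | h | h <;> simp [h]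
    · rw [Finset.disjoint_left]; intro p; simp; intro h; constructor
      · exact h.le
      · exact h.ne
    · rw [Finset.disjoint_left]; intro p; simp; intro h; exact h.ne'
  rw [h1, h2] at h3
  have h4 := congrArg (Nat.cast : ℕ → ℝ) h3
  push_cast at h4
  linarith

/-- **Norm bound for the Jastrow-type trial function** (Eq. (3.9)).
If `Ψ(𝐱₁,…,𝐱ₙ) = ∏_{i<j} F(|xᵢ−xⱼ|) ∏ₖ s_h(z_k)` with `0 ≤ F ≤ 1`, `F(r) = 1`
for `r ≥ b`, and `s_h` normalized in `L²(ℝ)`, then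
`∫_{Λ₂ⁿ×ℝⁿ} |Ψ|² ≥ ℓ^{2n} [1 − (π/2) n(n−1) b²/ℓ²]`, `Λ₂` a box of side `ℓ`. -/
theorem jastrow_norm_lower_bound
    (n : ℕ) (ℓ b : ℝ) (F : ℝ → ℝ) (sh : ℝ → ℝ)
    (hℓ : 0 < ℓ) (hb : 0 < b)
    (hFmeas : Measurable F) (hF0 : ∀ r, 0 ≤ F r) (hF1 : ∀ r, F r ≤ 1)
    (hFb : ∀ r : ℝ, b ≤ r → F r = 1)
    (hshmeas : Measurable sh) (hshint : Integrable (fun z => sh z ^ 2))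
    (hshnorm : (∫ z : ℝ, sh z ^ 2) = 1) :
    ℓ ^ (2 * n) * (1 - π / 2 * (n : ℝ) * ((n : ℝ) - 1) * b ^ 2 / ℓ ^ 2) ≤
      ∫ X in {X : Fin n → E2 | ∀ i, ∀ j : Fin 2, X i j ∈ Set.Icc (0 : ℝ) ℓ},
        ∫ Z : Fin n → ℝ,
          ((∏ i, ∏ j, if i < j then F (dist (X i) (X j)) else 1) ^ 2
            * ∏ k, sh (Z k) ^ 2) := by
  classical
  have hinner : ∀ X : Fin n → E2, (∫ Z : Fin n → ℝ,
          ((∏ i, ∏ j, if i < j then F (dist (X i) (X j)) else 1) ^ 2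
            * ∏ k, sh (Z k) ^ 2)) =
      (∏ i, ∏ j, if i < j then F (dist (X i) (X j)) else 1) ^ 2 := by
    intro X
    rw [integral_const_mul, integral_fintype_prod_volume_eq_pow (fun z => sh z ^ 2), hshnorm]
    simp
  have hset : {X : Fin n → E2 | ∀ i, ∀ j : Fin 2, X i j ∈ Set.Icc (0 : ℝ) ℓ} = cbox n ℓ := by
    ext X; simp [cbox, box2]
  simp_rw [hinner]
  rw [hset]
  set G : (Fin n → E2) → ℝ := fun X =>
    (∏ i, ∏ j, if i < j then F (dist (X i) (X j)) else 1) ^ 2 with hG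
  have hGm : Measurable G := by
    refine Measurable.pow_const ?_ 2
    refine Finset.measurable_prod _ fun i _ => Finset.measurable_prod _ fun j _ => ?_
    by_cases h : i < j
    · simp only [h, if_true]
      exact hFmeas.comp ((measurable_pi_apply i).dist (measurable_pi_apply j))
    · simp only [h, if_false]; exact measurable_const
  have hG0 : ∀ X, 0 ≤ G X := fun X => sq_nonneg _
  have hG1 : ∀ X, G X ≤ 1 := by
    intro X
    refine pow_le_one₀ ?_ ?_
    · refine Finset.prod_nonneg fun i _ => Finset.prod_nonneg fun j _ => ?_
      split_ifs
      exacts [hF0 _, zero_le_one]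
    · refine Finset.prod_le_one (fun i _ => Finset.prod_nonneg fun j _ => ?_)
        fun i _ => Finset.prod_le_one (fun j _ => ?_) fun j _ => ?_ <;> split_ifs
      exacts [hF0 _, zero_le_one, hF0 _, zero_le_one, hF1 _, le_rfl]
  have hvol : volume.real (cbox n ℓ) = ℓ ^ (2 * n) := by
    simp [Measure.real, volume_cbox, ENNReal.toReal_ofReal hℓ.le]
  have hfin : volume (cbox n ℓ) ≠ ⊤ := by rw [volume_cbox]; finiteness
  have hGi : IntegrableOn G (cbox n ℓ) := by
    refine Measure.integrableOn_of_bounded (M := 1) hfin hGm.aestronglyMeasurable ?_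
    refine Filter.Eventually.of_forall fun X => ?_
    rw [Real.norm_of_nonneg (hG0 X)]; exact hG1 X
  let P := Finset.univ.filter fun p : Fin n × Fin n => p.1 < p.2
  let A : Fin n × Fin n → Set (Fin n → E2) := fun p =>
    cbox n ℓ ∩ {X | dist (X p.1) (X p.2) < b}
  have hAm : ∀ p, MeasurableSet (A p) := fun p =>
    (measurableSet_cbox n ℓ).inter
      (measurableSet_lt ((measurable_pi_apply _).dist (measurable_pi_apply _)) measurable_const)
  let B : Set (Fin n → E2) := ⋃ p ∈ P, A p
  have hBm : MeasurableSet B := Finset.measurableSet_biUnion _ fun p _ => hAm p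
  have hBsub : B ⊆ cbox n ℓ := Set.iUnion₂_subset fun p _ => Set.inter_subset_left
  have hB : volume.real B ≤ (n * (n - 1) / 2 : ℝ) * (ℓ ^ (2 * n) * (π * b ^ 2 / ℓ ^ 2)) := by
    calc volume.real B ≤ ∑ p ∈ P, volume.real (A p) := measureReal_biUnion_finset_le _ _
      _ ≤ ∑ p ∈ P, ℓ ^ (2 * n) * (π * b ^ 2 / ℓ ^ 2) := by
          refine Finset.sum_le_sum fun p hp => real_pair n ℓ b hℓ hb p.1 p.2 ?_
          exact (Finset.mem_filter.1 hp).2.ne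
      _ = _ := by rw [Finset.sum_const, nsmul_eq_mul, card_pairs]
  have hdiff : volume.real (cbox n ℓ \ B) = ℓ ^ (2 * n) - volume.real B := by
    rw [measureReal_sdiff hBsub hBm hfin, hvol]
  have hone : ∀ X ∈ cbox n ℓ \ B, G X = 1 := by
    rintro X ⟨hX, hXB⟩
    have : (∏ i, ∏ j, if i < j then F (dist (X i) (X j)) else 1) = 1 := by
      refine Finset.prod_eq_one fun i _ => Finset.prod_eq_one fun j _ => ?_
      split_ifs with hij
      · apply hFb
        by_contra! hlt
        exact hXB (Set.mem_iUnion₂.2 ⟨(i, j), by simp [P, hij], hX, hlt⟩)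
      · rfl
    simp [hG, this]
  have hmain : volume.real (cbox n ℓ \ B) ≤ ∫ X in cbox n ℓ, G X := by
    calc volume.real (cbox n ℓ \ B) = ∫ X in cbox n ℓ \ B, G X := by
          rw [setIntegral_congr_fun ((measurableSet_cbox n ℓ).diff hBm) hone]; simp
      _ ≤ _ := setIntegral_mono_set hGi (Filter.Eventually.of_forall hG0)
          (Filter.Eventually.of_forall fun X hX => hX.1)
  refine le_trans (le_of_eq_of_le ?_ (sub_le_sub_left hB (ℓ ^ (2 * n)))) (hdiff ▸ hmain)
  ring

end
end
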